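/- There exists a compactly supported probability measure μ* on ℝ (namely the free additive convolution of the semicircle distribution with the atomic measure ∑_{j=1}^r q_j δ_{a_j}) such that the zero counting measures ν_N converge weakly to μ* as N → ∞, and the Cauchy–Stieltjes transform G(z) = ∫ (z − x)^{−1} μ*(dx) of μ* satisfies, for every z ∈ ℂ outside the support of μ*, the algebraic equation G(z) · ∏_{i=1}^r ( z − G(z) − a_i ) = ∑_{i=1}^r q_i ∏_{j≠i} ( z − G(z) − a_j ). -/

import Mathlib

namespace MultipleHermite

open MeasureTheory Finset Filter Polynomial

/-- The operator `f ↦ X * f - derivative f` on real polynomials. -/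
noncomputable def raising : Module.End ℝ ℝ[X] := LinearMap.mulLeft ℝ X - derivative

/-- The operator `f ↦ X * f + derivative f` on real polynomials. -/
noncomputable def coraising : Module.End ℝ ℝ[X] := LinearMap.mulLeft ℝ X + derivative

/-- The backward heat flow `f ↦ exp (-D² / 2) f`, realised as `f (X - D)` applied to `1`. -/
noncomputable def heat (f : ℝ[X]) : ℝ[X] := aeval raising f 1

/-- The inverse `f ↦ exp (D² / 2) f` of `heat`, realised as `f (X + D)` applied to `1`. -/
noncomputable def invHeat (f : ℝ[X]) : ℝ[X] := aeval coraising f 1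

lemma heat_add (f g : ℝ[X]) : heat (f + g) = heat f + heat g := by simp [heat]

lemma heat_one : heat 1 = 1 := by simp [heat]

lemma heat_C_mul (c : ℝ) (f : ℝ[X]) : heat (C c * f) = C c * heat f := by
  simp [heat, Module.algebraMap_end_apply, smul_eq_C_mul]

lemma heat_sum {ι : Type*} (s : Finset ι) (f : ι → ℝ[X]) :
    heat (∑ i ∈ s, f i) = ∑ i ∈ s, heat (f i) := by simp [heat]

lemma heat_X_mul (f : ℝ[X]) : heat (X * f) = X * heat f - derivative (heat f) := by
  simp [heat, raising]

lemma derivative_heat (f : ℝ[X]) : derivative (heat f) = heat (derivative f) := by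
  induction f using Polynomial.induction_on with
  | C a => simp [heat, Module.algebraMap_end_apply]
  | add p q hp hq => simp [heat_add, hp, hq]
  | monomial n a ih =>
    have e : C a * X ^ (n + 1) = X * (C a * X ^ n) := by ring
    rw [e, heat_X_mul, derivative_mul (f := X), heat_add, derivative_sub, derivative_mul, ih,
      heat_X_mul]
    simp
    ring

lemma X_mul_heat (f : ℝ[X]) : X * heat f = heat (coraising f) := by
  simp [coraising, heat_add, heat_X_mul, derivative_heat]

lemma heat_invHeat (f : ℝ[X]) : heat (invHeat f) = f := by
  induction f using Polynomial.induction_on with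
  | C a => simp [heat, invHeat, Module.algebraMap_end_apply, smul_eq_C_mul]
  | add p q hp hq =>
    have : invHeat (p + q) = invHeat p + invHeat q := by simp [invHeat]
    rw [this, heat_add, hp, hq]
  | monomial n a ih =>
    have e : C a * X ^ (n + 1) = X * (C a * X ^ n) := by ring
    have : invHeat (X * (C a * X ^ n)) = coraising (invHeat (C a * X ^ n)) := by
      simp [invHeat]
    rw [e, this, ← X_mul_heat, ih]

lemma invHeat_X_pow_monic (n : ℕ) :
    (invHeat (X ^ n)).Monic ∧ (invHeat (X ^ n)).natDegree = n := by
  induction n with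
  | zero => simp [invHeat]
  | succ n ih =>
    have e : invHeat (X ^ (n + 1)) = X * invHeat (X ^ n) + derivative (invHeat (X ^ n)) := by
      simp [invHeat, coraising, pow_succ']
    have hm : (X * invHeat (X ^ n)).Monic := monic_X.mul ih.1
    have hd : (X * invHeat (X ^ n)).natDegree = n + 1 := by
      rw [natDegree_X_mul ih.1.ne_zero, ih.2]
    have hlt : (derivative (invHeat (X ^ n))).degree < (X * invHeat (X ^ n)).degree := by
      rw [degree_eq_natDegree hm.ne_zero, hd]
      refine (degree_derivative_le).trans_lt ?_
      rw [degree_eq_natDegree ih.1.ne_zero, ih.2]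
      exact_mod_cast n.lt_succ_self
    rw [e]
    exact ⟨hm.add_of_left hlt, by rw [natDegree_add_eq_left_of_degree_lt hlt, hd]⟩

lemma invHeat_monic {f : ℝ[X]} (hf : f.Monic) :
    (invHeat f).Monic ∧ (invHeat f).natDegree = f.natDegree := by
  have e : invHeat f = invHeat (X ^ f.natDegree) +
      ∑ i ∈ range f.natDegree, C (f.coeff i) * invHeat (X ^ i) := by
    conv_lhs => rw [hf.as_sum]
    simp [invHeat, smul_eq_C_mul, Module.algebraMap_end_apply]
  have h := invHeat_X_pow_monic f.natDegree
  have hlt : (∑ i ∈ range f.natDegree, C (f.coeff i) * invHeat (X ^ i)).degree <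
      (invHeat (X ^ f.natDegree)).degree := by
    rw [degree_eq_natDegree h.1.ne_zero, h.2]
    refine (degree_sum_le _ _).trans_lt ?_
    rw [Finset.sup_lt_iff (WithBot.bot_lt_coe _)]
    intro i hi
    refine (degree_mul_le _ _).trans_lt ?_
    refine (add_le_add_left degree_C_le _).trans_lt ?_
    rw [degree_eq_natDegree (invHeat_X_pow_monic i).1.ne_zero, (invHeat_X_pow_monic i).2]
    simpa using hi
  rw [e]
  exact ⟨h.1.add_of_left hlt, by rw [natDegree_add_eq_left_of_degree_lt hlt, h.2]⟩

lemma integrable_polynomial_mul_exp (f : ℝ[X]) (c : ℝ) :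
    Integrable fun t : ℝ => f.eval t * Real.exp (c * t) * Real.exp (-t ^ 2 / 2) := by
  have key : ∀ g : ℝ[X], Integrable fun t : ℝ => g.eval t * Real.exp (-t ^ 2 / 2) := by
    intro g
    induction g using Polynomial.induction_on' with
    | add p q hp hq => exact (hp.add hq).congr (Eventually.of_forall fun t => by simp [add_mul])
    | monomial n a =>
      have h := (integrable_rpow_mul_exp_neg_mul_sq (b := 1 / 2) (by norm_num) (s := n)
        (by have : (0 : ℝ) ≤ n := by positivity
            linarith)).const_mul a
      refine h.congr (Eventually.of_forall fun t => ?_)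
      simp only [eval_monomial, Real.rpow_natCast, mul_assoc]
      congr 3
      ring
  have h := ((key (f.comp (X + C c))).comp_sub_right c).mul_const (Real.exp (c ^ 2 / 2))
  refine h.congr (Eventually.of_forall fun t => ?_)
  simp only [eval_comp, eval_add, eval_X, eval_C, sub_add_cancel, mul_assoc, ← Real.exp_add]
  congr 2
  ring

/-- The linear functional `f ↦ ∫ f(t) exp(c t - t² / 2) dt`. -/
noncomputable def gaussInt (c : ℝ) (f : ℝ[X]) : ℝ :=
  ∫ t : ℝ, f.eval t * Real.exp (c * t) * Real.exp (-t ^ 2 / 2)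

lemma gaussInt_add (c : ℝ) (f g : ℝ[X]) : gaussInt c (f + g) = gaussInt c f + gaussInt c g := by
  simp only [gaussInt, eval_add, add_mul]
  exact integral_add (integrable_polynomial_mul_exp f c) (integrable_polynomial_mul_exp g c)

lemma gaussInt_C_mul (c a : ℝ) (f : ℝ[X]) : gaussInt c (C a * f) = a * gaussInt c f := by
  simp only [gaussInt, eval_mul, eval_C, mul_assoc]
  exact integral_const_mul _ _

lemma gaussInt_one_pos (c : ℝ) : 0 < gaussInt c 1 := by
  have h := integrable_polynomial_mul_exp 1 c
  simp only [gaussInt]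
  refine (integral_pos_iff_support_of_nonneg (fun t => ?_) h).2 ?_
  · simp only [eval_one, Pi.zero_apply]; positivity
  · have : (Function.support fun t : ℝ =>
        (1 : ℝ[X]).eval t * Real.exp (c * t) * Real.exp (-t ^ 2 / 2)) = Set.univ := by
      ext t; simp [Real.exp_ne_zero]
    rw [this]; simp

lemma gaussInt_X_mul (c : ℝ) (f : ℝ[X]) :
    gaussInt c (X * f - derivative f) = c * gaussInt c f := by
  have hd : ∀ t : ℝ, HasDerivAt
      (fun t : ℝ => f.eval t * Real.exp (c * t) * Real.exp (-t ^ 2 / 2))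
      ((C c * f - (X * f - derivative f)).eval t * Real.exp (c * t) * Real.exp (-t ^ 2 / 2)) t := by
    intro t
    have h1 : HasDerivAt (fun t : ℝ => Real.exp (c * t)) (Real.exp (c * t) * (c * 1)) t :=
      ((hasDerivAt_id t).const_mul c).exp
    have h2 : HasDerivAt (fun t : ℝ => Real.exp (-t ^ 2 / 2))
        (Real.exp (-t ^ 2 / 2) * (-(2 * t) / 2)) t := by
      have := ((hasDerivAt_pow 2 t).neg.div_const 2).exp
      simpa using this
    convert! ((f.hasDerivAt t).mul h1).mul h2 using 1
    simp
    ring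
  have h := integral_eq_zero_of_hasDerivAt_of_integrable hd
    (integrable_polynomial_mul_exp _ c) (integrable_polynomial_mul_exp _ c)
  have h' : gaussInt c (C c * f + C (-1) * (X * f - derivative f)) = 0 := by
    rw [← h]; simp [gaussInt, sub_eq_add_neg, add_comm]
  rw [gaussInt_add, gaussInt_C_mul, gaussInt_C_mul] at h'
  linarith

lemma gaussInt_heat (c : ℝ) (f : ℝ[X]) : gaussInt c (heat f) = f.eval c * gaussInt c 1 := by
  induction f using Polynomial.induction_on with
  | C a =>
    have := gaussInt_C_mul c a 1
    have e : heat (C a) = C a * 1 := by rw [← heat_one, ← heat_C_mul, mul_one]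
    rw [e, this, eval_C]
  | add p q hp hq => rw [heat_add, gaussInt_add, hp, hq, eval_add, add_mul]
  | monomial n a ih =>
    have e : C a * X ^ (n + 1) = X * (C a * X ^ n) := by ring
    rw [e, heat_X_mul, gaussInt_X_mul, ih, eval_mul (p := X), eval_X]
    ring

lemma gaussInt_X_pow_mul_heat (c : ℝ) (f : ℝ[X]) (k : ℕ) :
    gaussInt c (X ^ k * heat f) = ((coraising ^ k) f).eval c * gaussInt c 1 := by
  induction k generalizing f with
  | zero => simp [gaussInt_heat]
  | succ k ih => rw [pow_succ, mul_assoc, X_mul_heat, ih, pow_succ]; simp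

lemma X_sub_C_pow_dvd_of_coraising {f : ℝ[X]} {c : ℝ} {n : ℕ}
    (h : ∀ k < n, ((coraising ^ k) f).eval c = 0) : (X - C c) ^ n ∣ f := by
  induction n generalizing f with
  | zero => simp
  | succ n ih =>
    have h1 : (X - C c) ^ n ∣ coraising f := ih fun k hk => by
      have := h (k + 1) (by omega)
      rwa [pow_succ, Module.End.mul_apply] at this
    obtain ⟨g, rfl⟩ : (X - C c) ^ n ∣ f := ih fun k hk => h k (by omega)
    rcases Nat.eq_zero_or_pos n with rfl | hn
    · have h0 := h 0 (by omega)
      simpa [dvd_iff_isRoot] using h0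
    · obtain ⟨m, rfl⟩ : ∃ m, n = m + 1 := ⟨n - 1, by omega⟩
      obtain ⟨q, hq⟩ := h1
      have hXc : X - C c ≠ 0 := X_sub_C_ne_zero c
      have hX : (X - C c) ^ m ≠ 0 := pow_ne_zero _ hXc
      have e : (X - C c) * X * g + C (m + 1 : ℝ) * g + (X - C c) * derivative g
          = (X - C c) * q := by
        apply mul_left_cancel₀ hX
        simp only [coraising, LinearMap.add_apply, LinearMap.mulLeft_apply, derivative_mul,
          derivative_X_sub_C_pow] at hq
        simp only [Nat.cast_add, Nat.cast_one, Nat.add_sub_cancel] at hq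
        linear_combination hq
      have hroot : g.eval c = 0 := by
        have := congrArg (eval c) e
        simp at this
        rcases this with h | h
        · exact absurd h (by positivity)
        · exact h
      obtain ⟨g', rfl⟩ := dvd_iff_isRoot.2 hroot
      exact ⟨g', by ring⟩

theorem eq_heat_of_orthogonal {ι : Type*} [Fintype ι] {c : ι → ℝ} (hc : Function.Injective c)
    {n : ι → ℕ} {f : ℝ[X]} (hf : f.Monic) (hdeg : f.natDegree = ∑ j, n j)
    (horth : ∀ j, ∀ k < n j, gaussInt (c j) (X ^ k * f) = 0) :
    f = heat (∏ j, (X - C (c j)) ^ n j) := by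
  have hd : ∏ j, (X - C (c j)) ^ n j ∣ invHeat f := by
    refine Fintype.prod_dvd_of_coprime (fun i j hij => ?_) fun j => ?_
    · exact (isCoprime_X_sub_C_of_isUnit_sub
        (sub_ne_zero.2 (hc.ne hij)).isUnit).pow
    · refine X_sub_C_pow_dvd_of_coraising fun k hk => ?_
      have := horth j k hk
      rw [← heat_invHeat f, gaussInt_X_pow_mul_heat] at this
      exact (mul_eq_zero.1 this).resolve_right (gaussInt_one_pos _).ne'
  have hm : (∏ j, (X - C (c j)) ^ n j).Monic :=
    monic_prod_of_monic _ _ fun j _ => (monic_X_sub_C _).pow _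
  have hnd : (∏ j, (X - C (c j)) ^ n j).natDegree = ∑ j, n j := by
    rw [natDegree_prod_of_monic _ _ fun j _ => (monic_X_sub_C _).pow _]
    simp
  have hi := invHeat_monic hf
  have : invHeat f = ∏ j, (X - C (c j)) ^ n j :=
    eq_of_monic_of_dvd_of_natDegree_le hm hi.1 hd (by rw [hi.2, hdeg, hnd])
  rw [← this, heat_invHeat]

lemma heat_prod_add_single {ι : Type*} [Fintype ι] [DecidableEq ι] (c : ι → ℝ) (n : ι → ℕ)
    (k : ι) :
    heat (∏ j, (X - C (c j)) ^ (n + Pi.single k 1 : ι → ℕ) j) =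
      (X - C (c k)) * heat (∏ j, (X - C (c j)) ^ n j) -
        derivative (heat (∏ j, (X - C (c j)) ^ n j)) := by
  have e : ∏ j, (X - C (c j)) ^ (n + Pi.single k 1 : ι → ℕ) j =
      X * ∏ j, (X - C (c j)) ^ n j + C (-c k) * ∏ j, (X - C (c j)) ^ n j := by
    simp only [Pi.add_apply, pow_add, Finset.prod_mul_distrib]
    rw [Fintype.prod_eq_single (f := fun j => (X - C (c j)) ^ (Pi.single k 1 : ι → ℕ) j) k
      (fun j hj => by simp [hj])]
    simp
    ring
  rw [e, heat_add, heat_X_mul, heat_C_mul]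
  simp
  ring

lemma derivative_heat_prod {ι : Type*} [Fintype ι] [DecidableEq ι] (c : ι → ℝ) (n : ι → ℕ) :
    derivative (heat (∏ j, (X - C (c j)) ^ n j)) =
      ∑ i, C (n i : ℝ) * heat (∏ j, (X - C (c j)) ^ (n - Pi.single i 1 : ι → ℕ) j) := by
  rw [derivative_heat, derivative_prod_finset, heat_sum]
  refine Finset.sum_congr rfl fun i _ => ?_
  rw [← heat_C_mul, derivative_X_sub_C_pow]
  have hp : ∏ j, (X - C (c j)) ^ (n - Pi.single i 1 : ι → ℕ) j =
      (∏ j ∈ univ.erase i, (X - C (c j)) ^ n j) * (X - C (c i)) ^ (n i - 1) := by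
    rw [← Finset.prod_erase_mul univ _ (mem_univ i)]
    congr 1
    · exact Finset.prod_congr rfl fun j hj => by simp [Finset.ne_of_mem_erase hj]
    · simp
  rw [hp]
  congr 1
  ring

lemma two_le_norm_sub {b g : ℂ} (hb : 3 ≤ ‖b‖) (hg : ‖g‖ ≤ 1 / 2) : 2 ≤ ‖b - g‖ := by
  have := norm_sub_norm_le b g
  linarith

lemma norm_inv_sub_inv_le {b g g' : ℂ} (hb : 3 ≤ ‖b‖) (hg : ‖g‖ ≤ 1 / 2) (hg' : ‖g'‖ ≤ 1 / 2) :
    ‖(b - g)⁻¹ - (b - g')⁻¹‖ ≤ ‖g - g'‖ / 4 := by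
  have h1 := two_le_norm_sub hb hg
  have h2 := two_le_norm_sub hb hg'
  have n1 : b - g ≠ 0 := norm_pos_iff.1 (by linarith)
  have n2 : b - g' ≠ 0 := norm_pos_iff.1 (by linarith)
  rw [inv_sub_inv n1 n2, norm_div, norm_mul, sub_sub_sub_cancel_left]
  gcongr
  nlinarith

lemma three_le_norm_sub {a A : ℝ} {w : ℂ} (ha : |a| ≤ A) (hw : A + 3 ≤ ‖w‖) : 3 ≤ ‖w - a‖ := by
  have h1 := norm_sub_norm_le w (a : ℂ)
  rw [Complex.norm_real, Real.norm_eq_abs] at h1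
  linarith

section Recurrence

variable {ι : Type*} [Fintype ι] [DecidableEq ι]

lemma sum_add_single (n : ι → ℕ) (k : ι) :
    ∑ j, (n + Pi.single k 1 : ι → ℕ) j = ∑ j, n j + 1 := by
  simp [Finset.sum_add_distrib]

omit [Fintype ι] in
lemma sub_single_add_single {n : ι → ℕ} {k : ι} (h : n k ≠ 0) :
    (n - Pi.single k 1 : ι → ℕ) + Pi.single k 1 = n := by
  ext j
  rcases eq_or_ne j k with rfl | hj
  · simp; omega
  · simp [hj]

/-- The data of a nearest-neighbour recurrence, as satisfied by the values at a fixed point `w` of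
the multiple Hermite polynomials, suitably rescaled. -/
structure NearestNeighbour (a : ι → ℝ) (A : ℝ) (N : ℕ) (w : ℂ) (e : (ι → ℕ) → ℂ) : Prop where
  pos : 0 < N
  abs_le : ∀ j, |a j| ≤ A
  le_norm : A + 3 ≤ ‖w‖
  zero : e 0 = 1
  step : ∀ n k, e (n + Pi.single k 1) =
    (w - a k) * e n - ∑ j, ((n j : ℂ) / N) * e (n - Pi.single j 1)

/-- The weighted sum of ratios of neighbouring values. -/
noncomputable def ratioSum (N : ℕ) (e : (ι → ℕ) → ℂ) (n : ι → ℕ) : ℂ :=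
  ∑ j, ((n j : ℂ) / N) * (e (n - Pi.single j 1) / e n)

namespace NearestNeighbour

variable {a : ι → ℝ} {A : ℝ} {N : ℕ} {w : ℂ} {e : (ι → ℕ) → ℂ}

lemma three_le (h : NearestNeighbour a A N w e) (j : ι) : 3 ≤ ‖w - a j‖ :=
  three_le_norm_sub (h.abs_le j) h.le_norm

lemma sum_div_le (h : NearestNeighbour a A N w e) {n : ι → ℕ} (hn : ∑ j, n j ≤ N) :
    ∑ j, (n j : ℝ) / N ≤ 1 := by
  rw [← Finset.sum_div, div_le_one (by exact_mod_cast h.pos)]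
  exact_mod_cast hn

lemma norm_sum_le (h : NearestNeighbour a A N w e) {n : ι → ℕ} (hn : ∑ j, n j ≤ N)
    {f : ι → ℂ} {B : ℝ} (hB : 0 ≤ B) (hf : ∀ j, n j ≠ 0 → ‖f j‖ ≤ B) :
    ‖∑ j, ((n j : ℂ) / N) * f j‖ ≤ B := by
  calc ‖∑ j, ((n j : ℂ) / N) * f j‖ ≤ ∑ j, ((n j : ℝ) / N) * B := by
        refine norm_sum_le_of_le _ fun j _ => ?_
        rw [norm_mul, norm_div, Complex.norm_natCast, Complex.norm_natCast]
        rcases eq_or_ne (n j) 0 with h0 | h0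
        · simp [h0]
        · gcongr; exact hf j h0
    _ = (∑ j, (n j : ℝ) / N) * B := by rw [Finset.sum_mul]
    _ ≤ 1 * B := by gcongr; exact h.sum_div_le hn
    _ = B := one_mul B

lemma step_of_ne_zero (h : NearestNeighbour a A N w e) {n : ι → ℕ} (k : ι) (hn : e n ≠ 0) :
    e (n + Pi.single k 1) = (w - a k - ratioSum N e n) * e n := by
  rw [h.step, sub_mul (w - (a k : ℂ)), ratioSum, Finset.sum_mul]
  congr 1
  refine Finset.sum_congr rfl fun j _ => ?_
  rw [mul_assoc, div_mul_cancel₀ _ hn]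

lemma ne_zero_and_norm_ratioSum_le (h : NearestNeighbour a A N w e) (n : ι → ℕ) (hn : ∑ j, n j ≤ N) :
    e n ≠ 0 ∧ ‖ratioSum N e n‖ ≤ 1 / 2 := by
  induction hm : ∑ j, n j using Nat.strong_induction_on generalizing n with
  | _ m ih =>
    have key : ∀ k, n k ≠ 0 → e n ≠ 0 ∧ ‖e (n - Pi.single k 1) / e n‖ ≤ 1 / 2 := by
      intro k hk
      have hs := sub_single_add_single hk
      have hsum := sum_add_single (n - Pi.single k 1) k
      rw [hs] at hsum
      obtain ⟨h1, h2⟩ := ih _ (by omega) (n - Pi.single k 1) (by omega) rfl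
      have hstep' : e n = (w - a k - ratioSum N e (n - Pi.single k 1)) *
          e (n - Pi.single k 1) := by
        rw [← h.step_of_ne_zero k h1, hs]
      have h5 := two_le_norm_sub (h.three_le k) h2
      have h6 : w - a k - ratioSum N e (n - Pi.single k 1) ≠ 0 := norm_pos_iff.1 (by linarith)
      refine ⟨by rw [hstep']; exact mul_ne_zero h6 h1, ?_⟩
      rw [hstep', div_mul_cancel_right₀ h1, norm_inv, one_div]
      gcongr
    refine ⟨?_, h.norm_sum_le hn (by norm_num) fun j hj => (key j hj).2⟩
    by_cases h0 : ∃ k, n k ≠ 0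
    · obtain ⟨k, hk⟩ := h0
      exact (key k hk).1
    · push Not at h0
      rw [show n = 0 from funext h0, h.zero]
      exact one_ne_zero

lemma ratio_eq (h : NearestNeighbour a A N w e) {n : ι → ℕ} (hn : ∑ j, n j ≤ N) (k : ι) :
    e n / e (n + Pi.single k 1) = (w - a k - ratioSum N e n)⁻¹ := by
  have h1 := (h.ne_zero_and_norm_ratioSum_le n hn).1
  rw [h.step_of_ne_zero k h1, div_mul_cancel_right₀ h1]

lemma ratioSum_eq (h : NearestNeighbour a A N w e) {n : ι → ℕ} (hn : ∑ j, n j ≤ N) :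
    ratioSum N e n =
      ∑ j, ((n j : ℂ) / N) * (w - a j - ratioSum N e (n - Pi.single j 1))⁻¹ := by
  refine Finset.sum_congr rfl fun j _ => ?_
  rcases eq_or_ne (n j) 0 with h0 | h0
  · simp [h0]
  · have hs := sub_single_add_single h0
    have hsum := sum_add_single (n - Pi.single j 1) j
    rw [hs] at hsum
    rw [← h.ratio_eq (by omega), hs]

lemma norm_ratioSum_sub_le (h : NearestNeighbour a A N w e) (n : ι → ℕ) (k : ι)
    (hn : ∑ j, n j + 1 ≤ N) :
    ‖ratioSum N e (n + Pi.single k 1) - ratioSum N e n‖ ≤ 1 / N := by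
  induction hm : ∑ j, n j using Nat.strong_induction_on generalizing n with
  | _ m ih =>
    have hk := sum_add_single n k
    have e1 : ratioSum N e (n + Pi.single k 1) =
        (1 / N : ℂ) * (w - a k - ratioSum N e n)⁻¹ + ∑ j, ((n j : ℂ) / N) *
          (w - a j - ratioSum N e (n + Pi.single k 1 - Pi.single j 1))⁻¹ := by
      rw [h.ratioSum_eq (by omega)]
      simp only [Pi.add_apply, Nat.cast_add, add_div, add_mul, Finset.sum_add_distrib]
      rw [add_comm]
      congr 1
      rw [Fintype.sum_eq_single k (fun j hj => by simp [hj])]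
      simp
    have e2 := h.ratioSum_eq (n := n) (by omega)
    rw [e1, add_sub_assoc]
    nth_rw 2 [e2]
    rw [← Finset.sum_sub_distrib]
    simp only [← mul_sub]
    have hN : (0 : ℝ) < 1 / N := by
      have := h.pos
      positivity
    have b1 : ‖(1 / N : ℂ) * (w - a k - ratioSum N e n)⁻¹‖ ≤ (1 / N) * (1 / 2) := by
      rw [norm_mul, norm_div, norm_one, Complex.norm_natCast]
      gcongr
      rw [norm_inv, one_div]
      have := two_le_norm_sub (h.three_le k) (h.ne_zero_and_norm_ratioSum_le n (by omega)).2
      gcongr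
    have b2 : ‖∑ j, ((n j : ℂ) / N) *
        ((w - a j - ratioSum N e (n + Pi.single k 1 - Pi.single j 1))⁻¹ -
          (w - a j - ratioSum N e (n - Pi.single j 1))⁻¹)‖ ≤ (1 / N) / 4 := by
      refine h.norm_sum_le (by omega) (by positivity) fun j hj => ?_
      have hs := sub_single_add_single hj
      have hsum := sum_add_single (n - Pi.single j 1) j
      rw [hs] at hsum
      have hc : n + Pi.single k 1 - Pi.single j 1 = n - Pi.single j 1 + Pi.single k 1 := by
        conv_lhs => rw [← hs, add_right_comm, add_tsub_cancel_right]
      have hk' := sum_add_single (n - Pi.single j 1) k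
      rw [hc]
      refine (norm_inv_sub_inv_le (h.three_le j) (h.ne_zero_and_norm_ratioSum_le _ (by omega)).2 (h.ne_zero_and_norm_ratioSum_le _ (by omega)).2).trans ?_
      gcongr
      exact ih _ (by omega) _ (by omega) rfl
    refine (norm_add_le _ _).trans ?_
    linarith

theorem norm_ratioSum_sub_sum_le (h : NearestNeighbour a A N w e) {n : ι → ℕ}
    (hn : ∑ j, n j ≤ N) :
    ‖ratioSum N e n - ∑ j, ((n j : ℂ) / N) * (w - a j - ratioSum N e n)⁻¹‖ ≤ 1 / N := by
  nth_rw 1 [h.ratioSum_eq hn]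
  rw [← Finset.sum_sub_distrib]
  simp only [← mul_sub]
  refine h.norm_sum_le hn (by positivity) fun j hj => ?_
  have hs := sub_single_add_single hj
  have hsum := sum_add_single (n - Pi.single j 1) j
  rw [hs] at hsum
  refine (norm_inv_sub_inv_le (h.three_le j) (h.ne_zero_and_norm_ratioSum_le _ (by omega)).2 (h.ne_zero_and_norm_ratioSum_le _ (by omega)).2).trans ?_
  have := h.norm_ratioSum_sub_le (n - Pi.single j 1) j (by omega)
  rw [hs, norm_sub_rev] at this
  have hN : (0 : ℝ) ≤ 1 / N := by positivity
  linarith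

end NearestNeighbour

end Recurrence

/-- The multiple Hermite polynomial with parameters `c` and multi-index `n`. -/
noncomputable def multHermite {ι : Type*} [Fintype ι] (c : ι → ℝ) (n : ι → ℕ) : ℝ[X] :=
  heat (∏ j, (X - C (c j)) ^ n j)

section Scaling

variable {ι : Type*} [Fintype ι] [DecidableEq ι] {a : ι → ℝ} {A : ℝ} {N : ℕ}

/-- The rescaled values of the multiple Hermite polynomials at `w`. -/
noncomputable def scaledValue (a : ι → ℝ) (N : ℕ) (w : ℂ) (n : ι → ℕ) : ℂ :=
  aeval ((√N : ℝ) * w) (multHermite (fun j => √N * a j) n) / ((√N : ℝ) : ℂ) ^ ∑ j, n j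

lemma ofReal_sqrt_mul_self (N : ℕ) : ((√N : ℝ) : ℂ) * ((√N : ℝ) : ℂ) = N := by
  rw [← Complex.ofReal_mul, Real.mul_self_sqrt (Nat.cast_nonneg N), Complex.ofReal_natCast]

lemma ofReal_sqrt_ne_zero (hN : 0 < N) : ((√N : ℝ) : ℂ) ≠ 0 := by
  simpa using hN.ne'

lemma sum_scaledValue_sub_single (hN : 0 < N) (w : ℂ) (n : ι → ℕ) :
    ∑ j, ((n j : ℂ) / N) * scaledValue a N w (n - Pi.single j 1) =
      aeval ((√N : ℝ) * w) (derivative (multHermite (fun j => √N * a j) n)) /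
        ((√N : ℝ) : ℂ) ^ (∑ j, n j + 1) := by
  rw [multHermite, derivative_heat_prod, map_sum, Finset.sum_div]
  refine Finset.sum_congr rfl fun j _ => ?_
  rcases eq_or_ne (n j) 0 with h0 | h0
  · simp [h0]
  have hs := sub_single_add_single h0
  have hsum := sum_add_single (n - Pi.single j 1) j
  rw [hs] at hsum
  have hne := ofReal_sqrt_ne_zero hN
  rw [scaledValue, multHermite, hsum, ← ofReal_sqrt_mul_self N, map_mul, aeval_C]
  simp only [Complex.coe_algebraMap, Complex.ofReal_natCast]
  field_simp
  ring

lemma nearestNeighbour_scaledValue (hN : 0 < N) (ha : ∀ j, |a j| ≤ A) {w : ℂ}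
    (hw : A + 3 ≤ ‖w‖) : NearestNeighbour a A N w (scaledValue a N w) where
  pos := hN
  abs_le := ha
  le_norm := hw
  zero := by simp [scaledValue, multHermite, heat_one]
  step n k := by
    have hne := ofReal_sqrt_ne_zero hN
    rw [sum_scaledValue_sub_single hN, scaledValue, scaledValue, sum_add_single, multHermite,
      heat_prod_add_single, ← multHermite, map_sub, map_mul, map_sub, aeval_X, aeval_C]
    simp only [Complex.coe_algebraMap, Complex.ofReal_mul]
    field_simp
    ring

/-- The Cauchy transform of the zero counting measure of `multHermite`, rescaled, at points `w` of
large modulus. -/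
theorem cauchy_zeros_bounds (hN : 0 < N) (ha : ∀ j, |a j| ≤ A) {w : ℂ} (hw : A + 3 ≤ ‖w‖)
    {n : ι → ℕ} (hn : ∑ j, n j = N) {z : Fin N → ℝ}
    (hz : multHermite (fun j => √N * a j) n = ∏ i, (X - C (z i))) :
    (∀ i, ((z i / √N : ℝ) : ℂ) ≠ w) ∧ ∃ g : ℂ,
      g = (N : ℂ)⁻¹ * ∑ i, (w - ((z i / √N : ℝ) : ℂ))⁻¹ ∧ ‖g‖ ≤ 1 / 2 ∧
      ‖g - ∑ j, ((n j : ℂ) / N) * (w - a j - g)⁻¹‖ ≤ 1 / N := by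
  have h := nearestNeighbour_scaledValue hN ha hw
  obtain ⟨h1, h2⟩ := h.ne_zero_and_norm_ratioSum_le n hn.le
  have hne := ofReal_sqrt_ne_zero hN
  have hval : aeval ((√N : ℝ) * w) (multHermite (fun j => √N * a j) n) =
      ∏ i, ((√N : ℝ) * w - z i) := by
    rw [hz, map_prod]; simp
  have hfac : ∀ i, ((√N : ℝ) : ℂ) * w - z i ≠ 0 := by
    have h3 : ∏ i, (((√N : ℝ) : ℂ) * w - z i) ≠ 0 := by
      rw [← hval]
      intro h0
      exact h1 (by rw [scaledValue, h0, zero_div])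
    exact fun i => Finset.prod_ne_zero_iff.1 h3 i (mem_univ i)
  have hmul : ∀ i, ((√N : ℝ) : ℂ) * (w - ((z i / √N : ℝ) : ℂ)) = (√N : ℝ) * w - z i := by
    intro i
    push_cast
    field_simp
  refine ⟨fun i hi => hfac i ?_, ratioSum N (scaledValue a N w) n, ?_, h2,
    h.norm_ratioSum_sub_sum_le hn.le⟩
  · rw [← hmul i, hi, sub_self, mul_zero]
  · have hd : aeval (((√N : ℝ) : ℂ) * w) (derivative (multHermite (fun j => √N * a j) n)) =
        (∏ i, (((√N : ℝ) : ℂ) * w - z i)) * ∑ i, (((√N : ℝ) : ℂ) * w - z i)⁻¹ := by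
      rw [hz, derivative_prod_finset, map_sum, Finset.mul_sum]
      refine Finset.sum_congr rfl fun i _ => ?_
      rw [← Finset.prod_erase_mul univ _ (mem_univ i), mul_assoc, mul_inv_cancel₀ (hfac i)]
      simp
    have hp : ∏ i, (((√N : ℝ) : ℂ) * w - z i) ≠ 0 :=
      Finset.prod_ne_zero_iff.2 fun i _ => hfac i
    have e1 : ratioSum N (scaledValue a N w) n =
        (∑ j, ((n j : ℂ) / N) * scaledValue a N w (n - Pi.single j 1)) / scaledValue a N w n := by
      rw [ratioSum, Finset.sum_div]
      exact Finset.sum_congr rfl fun j _ => by rw [mul_div_assoc]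
    rw [e1, sum_scaledValue_sub_single hN, scaledValue, hd, hval, pow_succ,
      ← ofReal_sqrt_mul_self N]
    simp only [← hmul, mul_inv_rev]
    simp only [hmul, ← Finset.sum_mul]
    field_simp

end Scaling

theorem abs_zero_lt {ι : Type*} [Fintype ι] {a : ι → ℝ} {A : ℝ} {N : ℕ}
    (hN : 0 < N) (ha : ∀ j, |a j| ≤ A) {n : ι → ℕ} (hn : ∑ j, n j = N) {z : Fin N → ℝ}
    (hz : multHermite (fun j => √N * a j) n = ∏ i, (X - C (z i))) (i : Fin N) :
    |z i / √N| < A + 3 := by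
  classical
  by_contra! hi
  refine (cauchy_zeros_bounds hN ha (w := ((z i / √N : ℝ) : ℂ)) ?_ hn hz).1 i rfl
  rwa [Complex.norm_real, Real.norm_eq_abs]

/-- The Cauchy–Stieltjes transform of a measure on the real line. -/
noncomputable def cauchyTransform (μ : Measure ℝ) (w : ℂ) : ℂ := ∫ x : ℝ, (w - (x : ℂ))⁻¹ ∂μ

lemma sub_ofReal_ne_zero {w : ℂ} (hw : w.im ≠ 0) (x : ℝ) : w - x ≠ 0 := by
  intro h
  apply hw
  simpa using congrArg Complex.im h

lemma abs_im_le_norm_sub (w : ℂ) (x : ℝ) : |w.im| ≤ ‖w - x‖ := by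
  simpa using Complex.abs_im_le_norm (w - x)

lemma continuous_inv_sub {w : ℂ} (hw : w.im ≠ 0) : Continuous fun x : ℝ => (w - (x : ℂ))⁻¹ :=
  (continuous_const.sub Complex.continuous_ofReal).inv₀ (sub_ofReal_ne_zero hw)

lemma aestronglyMeasurable_inv_sub (μ : Measure ℝ) (w : ℂ) :
    AEStronglyMeasurable (fun x : ℝ => (w - (x : ℂ))⁻¹) μ :=
  (measurable_const.sub Complex.measurable_ofReal).inv.aestronglyMeasurable

lemma differentiableAt_cauchyTransform (μ : Measure ℝ) [IsFiniteMeasure μ] {w : ℂ} {δ : ℝ}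
    (hδ : 0 < δ) (h : ∀ᵐ x : ℝ ∂μ, δ ≤ ‖w - x‖) : DifferentiableAt ℂ (cauchyTransform μ) w := by
  have hfar : ∀ᵐ x : ℝ ∂μ, ∀ v ∈ Metric.ball w (δ / 2), δ / 2 ≤ ‖v - x‖ := by
    filter_upwards [h] with x hx v hv
    rw [Metric.mem_ball, dist_eq_norm] at hv
    have : ‖w - x‖ ≤ ‖v - w‖ + ‖v - x‖ := by
      rw [norm_sub_rev v w]
      calc ‖w - x‖ = ‖(w - v) + (v - x)‖ := by ring_nf
        _ ≤ _ := norm_add_le _ _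
    linarith
  refine (hasDerivAt_integral_of_dominated_loc_of_deriv_le (μ := μ)
    (F := fun (v : ℂ) (x : ℝ) => (v - (x : ℂ))⁻¹)
    (F' := fun (v : ℂ) (x : ℝ) => -1 / (v - (x : ℂ)) ^ 2) (x₀ := w)
    (bound := fun _ => 1 / (δ / 2) ^ 2) (Metric.ball_mem_nhds w (half_pos hδ))
    (Eventually.of_forall fun v => aestronglyMeasurable_inv_sub μ v) ?_ ?_ ?_
    (integrable_const _) ?_).2.differentiableAt
  · refine (integrable_const (1 / δ)).mono' (aestronglyMeasurable_inv_sub μ w) ?_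
    filter_upwards [h] with x hx
    rw [norm_inv, one_div]
    gcongr
  · exact (measurable_const.div
      ((measurable_const.sub Complex.measurable_ofReal).pow_const 2)).aestronglyMeasurable
  · filter_upwards [hfar] with x hx v hv
    rw [norm_div, norm_neg, norm_one, norm_pow]
    have := hx v hv
    gcongr
  · filter_upwards [hfar] with x hx v hv
    have hne : v - (x : ℂ) ≠ 0 := norm_pos_iff.1 ((half_pos hδ).trans_le (hx v hv))
    exact ((hasDerivAt_id v).sub_const (x : ℂ)).inv hne

section Uniqueness

variable {μ μ' : Measure ℝ} [IsProbabilityMeasure μ] [IsProbabilityMeasure μ'] {R : ℝ}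

lemma integrable_of_continuous_of_compl_Icc {E : Type*} [NormedAddCommGroup E]
    (hμ : μ (Set.Icc (-R) R)ᶜ = 0) {f : ℝ → E} (hf : Continuous f) : Integrable f μ := by
  rw [← Measure.restrict_eq_self_of_ae_mem (s := Set.Icc (-R) R) (μ := μ) hμ]
  exact hf.continuousOn.integrableOn_compact isCompact_Icc

lemma tendsto_mul_integral_pow_mul_inv (hμ : μ (Set.Icc (-R) R)ᶜ = 0) (k : ℕ) :
    Tendsto (fun n : ℕ => ((n : ℂ) * Complex.I) *
      ∫ x : ℝ, (x : ℂ) ^ k * ((n : ℂ) * Complex.I - x)⁻¹ ∂μ) atTop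
      (nhds (∫ x : ℝ, (x : ℂ) ^ k ∂μ)) := by
  simp only [← integral_const_mul]
  refine tendsto_integral_filter_of_dominated_convergence (fun x : ℝ => |x| ^ k) ?_ ?_ ?_ ?_
  · refine Eventually.of_forall fun n => Measurable.aestronglyMeasurable ?_
    exact measurable_const.mul ((Complex.measurable_ofReal.pow_const k).mul
      (measurable_const.sub Complex.measurable_ofReal).inv)
  · refine Eventually.of_forall fun n => Eventually.of_forall fun x => ?_
    rw [mul_left_comm, norm_mul, norm_pow, Complex.norm_real, Real.norm_eq_abs]
    refine mul_le_of_le_one_right (by positivity) ?_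
    rw [norm_mul, norm_inv, ← div_eq_mul_inv]
    refine div_le_one_of_le₀ ?_ (norm_nonneg _)
    simpa using Complex.abs_im_le_norm ((n : ℂ) * Complex.I - x)
  · exact integrable_of_continuous_of_compl_Icc hμ (by fun_prop)
  · refine Eventually.of_forall fun x => ?_
    have h1 : Tendsto (fun n : ℕ => (x : ℂ) * ((n : ℂ) * Complex.I)⁻¹) atTop (nhds 0) := by
      have h2 : Tendsto (fun n : ℕ => ((n : ℂ))⁻¹) atTop (nhds 0) :=
        tendsto_inv_atTop_nhds_zero_nat
      have h3 := (h2.mul_const (Complex.I⁻¹)).const_mul (x : ℂ)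
      simpa [mul_comm] using h3
    have h4 : Tendsto (fun n : ℕ => (x : ℂ) ^ k * (1 - (x : ℂ) * ((n : ℂ) * Complex.I)⁻¹)⁻¹)
        atTop (nhds ((x : ℂ) ^ k * (1 - 0)⁻¹)) :=
      ((h1.const_sub 1).inv₀ (by simp)).const_mul _
    rw [sub_zero, inv_one, mul_one] at h4
    refine h4.congr' ?_
    filter_upwards [eventually_gt_atTop 0] with n hn
    have hnI : (n : ℂ) * Complex.I ≠ 0 := by simp [hn.ne']
    have e : (n : ℂ) * Complex.I - x = ((n : ℂ) * Complex.I) *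
        (1 - (x : ℂ) * ((n : ℂ) * Complex.I)⁻¹) := by
      rw [mul_sub, mul_one, mul_comm (x : ℂ), mul_inv_cancel_left₀ hnI]
    rw [e, mul_inv ((n : ℂ) * Complex.I) (1 - _), mul_left_comm, mul_inv_cancel_left₀ hnI]

lemma integral_pow_eq_of_cauchyTransform_eq (hμ : μ (Set.Icc (-R) R)ᶜ = 0)
    (hμ' : μ' (Set.Icc (-R) R)ᶜ = 0)
    (h : ∀ w : ℂ, w.im ≠ 0 → R ≤ ‖w‖ → cauchyTransform μ w = cauchyTransform μ' w) (k : ℕ) :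
    ∫ x : ℝ, x ^ k ∂μ = ∫ x : ℝ, x ^ k ∂μ' := by
  have hstep : ∀ k : ℕ, (∀ w : ℂ, w.im ≠ 0 → R ≤ ‖w‖ →
      ∫ x : ℝ, (x : ℂ) ^ k * (w - x)⁻¹ ∂μ = ∫ x : ℝ, (x : ℂ) ^ k * (w - x)⁻¹ ∂μ') →
      ∫ x : ℝ, (x : ℂ) ^ k ∂μ = ∫ x : ℝ, (x : ℂ) ^ k ∂μ' := by
    intro k hk
    refine tendsto_nhds_unique (tendsto_mul_integral_pow_mul_inv hμ k)
      ((tendsto_mul_integral_pow_mul_inv hμ' k).congr' ?_)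
    filter_upwards [eventually_gt_atTop 0, eventually_ge_atTop ⌈R⌉₊] with n hn hnR
    rw [hk _ (by simpa using hn.ne')]
    simpa using (Nat.le_ceil R).trans (Nat.cast_le.2 hnR)
  have hrec : ∀ (ρ : Measure ℝ) [IsProbabilityMeasure ρ], ρ (Set.Icc (-R) R)ᶜ = 0 →
      ∀ (k : ℕ) (w : ℂ), w.im ≠ 0 → ∫ x : ℝ, (x : ℂ) ^ (k + 1) * (w - x)⁻¹ ∂ρ =
        w * ∫ x : ℝ, (x : ℂ) ^ k * (w - x)⁻¹ ∂ρ - ∫ x : ℝ, (x : ℂ) ^ k ∂ρ := by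
    intro ρ _ hρ k w hw
    have hc := continuous_inv_sub hw
    rw [← integral_const_mul, ← integral_sub]
    · refine integral_congr_ae (Eventually.of_forall fun x => ?_)
      have := sub_ofReal_ne_zero hw x
      field_simp
      ring
    · exact integrable_of_continuous_of_compl_Icc hρ (by fun_prop)
    · exact integrable_of_continuous_of_compl_Icc hρ (by fun_prop)
  have hall : ∀ k : ℕ, ∀ w : ℂ, w.im ≠ 0 → R ≤ ‖w‖ →
      ∫ x : ℝ, (x : ℂ) ^ k * (w - x)⁻¹ ∂μ = ∫ x : ℝ, (x : ℂ) ^ k * (w - x)⁻¹ ∂μ' := by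
    intro k
    induction k with
    | zero => simpa [cauchyTransform] using h
    | succ k ih =>
      intro w hw hR
      rw [hrec μ hμ k w hw, hrec μ' hμ' k w hw, ih w hw hR, hstep k ih]
  have := hstep k (hall k)
  simp only [← Complex.ofReal_pow, integral_complex_ofReal] at this
  exact_mod_cast this

theorem eq_of_cauchyTransform_eq (hμ : μ (Set.Icc (-R) R)ᶜ = 0) (hμ' : μ' (Set.Icc (-R) R)ᶜ = 0)
    (h : ∀ w : ℂ, w.im ≠ 0 → R ≤ ‖w‖ → cauchyTransform μ w = cauchyTransform μ' w) : μ = μ' := by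
  have hpoly : ∀ p : ℝ[X], ∫ x, p.eval x ∂μ = ∫ x, p.eval x ∂μ' := by
    intro p
    induction p using Polynomial.induction_on' with
    | add p q hp hq =>
      simp only [eval_add]
      rw [integral_add (integrable_of_continuous_of_compl_Icc hμ p.continuous)
        (integrable_of_continuous_of_compl_Icc hμ q.continuous),
        integral_add (integrable_of_continuous_of_compl_Icc hμ' p.continuous)
        (integrable_of_continuous_of_compl_Icc hμ' q.continuous), hp, hq]
    | monomial n a =>
      simp only [eval_monomial, integral_const_mul,
        integral_pow_eq_of_cauchyTransform_eq hμ hμ' h n]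
  have hnear : ∀ (ρ : Measure ℝ) [IsProbabilityMeasure ρ], ρ (Set.Icc (-R) R)ᶜ = 0 →
      ∀ (f : BoundedContinuousFunction ℝ ℝ) (p : ℝ[X]) (ε : ℝ),
      (∀ x ∈ Set.Icc (-R) R, |p.eval x - f x| < ε) →
      |∫ x, p.eval x ∂ρ - ∫ x, f x ∂ρ| ≤ ε := by
    intro ρ _ hρ f p ε hp
    rw [← integral_sub (integrable_of_continuous_of_compl_Icc hρ p.continuous)
      (integrable_of_continuous_of_compl_Icc hρ f.continuous)]
    have h1 : ∀ᵐ x ∂ρ, ‖p.eval x - f x‖ ≤ ε := by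
      have : ∀ᵐ x ∂ρ, x ∈ Set.Icc (-R) R := hρ
      filter_upwards [this] with x hx using (hp x hx).le
    simpa using norm_integral_le_of_norm_le_const h1
  refine ext_of_forall_integral_eq_of_IsFiniteMeasure fun f => ?_
  refine eq_of_forall_dist_le fun ε hε => ?_
  obtain ⟨p, hp⟩ := exists_polynomial_near_of_continuousOn (-R) R f f.continuous.continuousOn
    (ε / 2) (half_pos hε)
  have h1 := hnear μ hμ f p _ hp
  have h2 := hnear μ' hμ' f p _ hp
  rw [hpoly p] at h1
  rw [Real.dist_eq]
  rw [abs_le] at h1 h2 ⊢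
  constructor <;> linarith

end Uniqueness

lemma exists_empirical_measure {N : ℕ} (hN : 0 < N) (x : Fin N → ℝ) :
    ∃ ν : ProbabilityMeasure ℝ,
      (∀ s : Set ℝ, MeasurableSet s → (∀ i, x i ∉ s) → (ν : Measure ℝ) s = 0) ∧
      (∀ f : ℝ → ℝ, ∫ t, f t ∂(ν : Measure ℝ) = (N : ℝ)⁻¹ * ∑ i, f (x i)) ∧
      ∀ f : ℝ → ℂ, ∫ t, f t ∂(ν : Measure ℝ) = (N : ℂ)⁻¹ * ∑ i, f (x i) := by
  have hp : IsProbabilityMeasure ((N : ENNReal)⁻¹ • ∑ i, Measure.dirac (x i)) := by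
    refine ⟨?_⟩
    have : (N : ENNReal) ≠ 0 := by exact_mod_cast hN.ne'
    simp [ENNReal.inv_mul_cancel this (ENNReal.natCast_ne_top N)]
  refine ⟨⟨_, hp⟩, fun s hs hx => ?_, fun f => ?_, fun f => ?_⟩
  · simp [hs, hx]
  · rw [ProbabilityMeasure.coe_mk, integral_smul_measure,
      integral_finsetSum_measure fun i _ => integrable_dirac (by simp)]
    simp
  · rw [ProbabilityMeasure.coe_mk, integral_smul_measure,
      integral_finsetSum_measure fun i _ => integrable_dirac (by simp)]
    simp

lemma tendsto_cauchyTransform {α : Type*} {F : Filter α} {ν : α → ProbabilityMeasure ℝ}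
    {μ : ProbabilityMeasure ℝ} (h : Tendsto ν F (nhds μ)) {w : ℂ} (hw : w.im ≠ 0) :
    Tendsto (fun i => cauchyTransform (ν i) w) F (nhds (cauchyTransform μ w)) := by
  rw [ProbabilityMeasure.tendsto_iff_forall_integral_rclike_tendsto ℂ] at h
  refine h (BoundedContinuousFunction.ofNormedAddCommGroup _ (continuous_inv_sub hw)
    (|w.im|⁻¹) fun x => ?_)
  rw [norm_inv]
  have := abs_im_le_norm_sub w x
  have := abs_pos.2 hw
  gcongr

section FixedPoint

variable {ι : Type*} [Fintype ι] {a q : ι → ℝ} {A : ℝ}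

lemma fixedPoint_unique (ha : ∀ j, |a j| ≤ A) (hq : ∀ j, 0 ≤ q j) (hq1 : ∑ j, q j = 1) {w : ℂ}
    (hw : A + 3 ≤ ‖w‖) {g g' : ℂ} (hg : ‖g‖ ≤ 1 / 2) (hg' : ‖g'‖ ≤ 1 / 2)
    (h : g = ∑ j, (q j : ℂ) * (w - a j - g)⁻¹) (h' : g' = ∑ j, (q j : ℂ) * (w - a j - g')⁻¹) :
    g = g' := by
  have key : ‖g - g'‖ ≤ ‖g - g'‖ / 4 := by
    calc ‖g - g'‖ = ‖∑ j, (q j : ℂ) * ((w - a j - g)⁻¹ - (w - a j - g')⁻¹)‖ := by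
          simp only [mul_sub (q _ : ℂ), Finset.sum_sub_distrib]
          rw [← h, ← h']
      _ ≤ ∑ j, q j * (‖g - g'‖ / 4) := by
          refine norm_sum_le_of_le _ fun j _ => ?_
          rw [norm_mul, Complex.norm_real, Real.norm_eq_abs, abs_of_nonneg (hq j)]
          have := norm_inv_sub_inv_le (three_le_norm_sub (ha j) hw) hg hg'
          have := hq j
          gcongr
      _ = ‖g - g'‖ / 4 := by rw [← Finset.sum_mul, hq1, one_mul]
  have : ‖g - g'‖ = 0 := by linarith [norm_nonneg (g - g')]
  exact sub_eq_zero.1 (norm_eq_zero.1 this)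

lemma fixedPoint_of_tendsto {α : Type*} {F : Filter α} [F.NeBot] (ha : ∀ j, |a j| ≤ A) {w : ℂ}
    (hw : A + 3 ≤ ‖w‖) {p : α → ι → ℂ} {g : α → ℂ} {ε : α → ℝ} {g₀ : ℂ}
    (hp : ∀ j, Tendsto (fun i => p i j) F (nhds (q j))) (hg : Tendsto g F (nhds g₀))
    (hε : Tendsto ε F (nhds 0)) (hbound : ∀ᶠ i in F, ‖g i‖ ≤ 1 / 2)
    (heq : ∀ᶠ i in F, ‖g i - ∑ j, p i j * (w - a j - g i)⁻¹‖ ≤ ε i) :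
    ‖g₀‖ ≤ 1 / 2 ∧ g₀ = ∑ j, (q j : ℂ) * (w - a j - g₀)⁻¹ := by
  have h1 : ‖g₀‖ ≤ 1 / 2 := le_of_tendsto hg.norm hbound
  refine ⟨h1, ?_⟩
  have h2 : Tendsto (fun i => g i - ∑ j, p i j * (w - a j - g i)⁻¹) F
      (nhds (g₀ - ∑ j, (q j : ℂ) * (w - a j - g₀)⁻¹)) := by
    refine hg.sub (tendsto_finsetSum _ fun j _ => (hp j).mul ((hg.const_sub _).inv₀ ?_))
    have := two_le_norm_sub (three_le_norm_sub (ha j) hw) h1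
    exact norm_pos_iff.1 (by linarith)
  exact sub_eq_zero.1 (tendsto_nhds_unique h2 (squeeze_zero_norm' heq hε))

variable [DecidableEq ι]

/-- The defect in the algebraic equation satisfied by the limiting Cauchy transform. -/
noncomputable def defect (a q : ι → ℝ) (G : ℂ → ℂ) (w : ℂ) : ℂ :=
  G w * ∏ i, (w - G w - (a i : ℂ)) -
    ∑ i, (q i : ℂ) * ∏ j ∈ univ.erase i, (w - G w - (a j : ℂ))

lemma defect_eq_zero_of_fixedPoint (ha : ∀ j, |a j| ≤ A) {G : ℂ → ℂ} {w : ℂ} (hw : A + 3 ≤ ‖w‖)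
    (hg : ‖G w‖ ≤ 1 / 2) (h : G w = ∑ j, (q j : ℂ) * (w - a j - G w)⁻¹) : defect a q G w = 0 := by
  rw [defect, sub_eq_zero]
  nth_rw 1 [h]
  rw [Finset.sum_mul]
  refine Finset.sum_congr rfl fun i _ => ?_
  rw [← Finset.mul_prod_erase univ _ (mem_univ i), mul_assoc, sub_right_comm w,
    inv_mul_cancel_left₀]
  rw [sub_right_comm w]
  have := two_le_norm_sub (three_le_norm_sub (ha i) hw) hg
  exact norm_pos_iff.1 (by linarith)

lemma differentiableAt_defect {G : ℂ → ℂ} {w : ℂ} (hG : DifferentiableAt ℂ G w) :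
    DifferentiableAt ℂ (defect a q G) w := by
  unfold defect
  fun_prop

lemma defect_cauchyTransform_eq_zero_of_im_ne_zero {μ : Measure ℝ} [IsProbabilityMeasure μ]
    (ha : ∀ j, |a j| ≤ A) (hA : 0 ≤ A)
    (h : ∀ w : ℂ, w.im ≠ 0 → A + 3 ≤ ‖w‖ → ‖cauchyTransform μ w‖ ≤ 1 / 2 ∧
      cauchyTransform μ w = ∑ j, (q j : ℂ) * (w - a j - cauchyTransform μ w)⁻¹)
    {w : ℂ} (hw : w.im ≠ 0) : defect a q (cauchyTransform μ) w = 0 := by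
  have hdiff : ∀ v : ℂ, v.im ≠ 0 → DifferentiableAt ℂ (defect a q (cauchyTransform μ)) v :=
    fun v hv => differentiableAt_defect (differentiableAt_cauchyTransform μ (abs_pos.2 hv)
      (Eventually.of_forall fun x => abs_im_le_norm_sub v x))
  have hev : ∀ v : ℂ, v.im ≠ 0 → A + 3 < ‖v‖ →
      defect a q (cauchyTransform μ) =ᶠ[nhds v] 0 := by
    intro v hv hvA
    have h1 : ∀ᶠ u : ℂ in nhds v, u.im ≠ 0 :=
      Complex.continuous_im.continuousAt.eventually_ne hv
    have h2 : ∀ᶠ u : ℂ in nhds v, A + 3 < ‖u‖ :=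
      continuous_norm.continuousAt.eventually_const_lt hvA
    filter_upwards [h1, h2] with u hu hu'
    obtain ⟨h3, h4⟩ := h u hu hu'.le
    exact defect_eq_zero_of_fixedPoint ha hu'.le h3 h4
  have hconn : ∀ S : Set ℂ, IsOpen S → IsPreconnected S → (∀ v ∈ S, v.im ≠ 0) →
      ∀ v ∈ S, A + 3 < ‖v‖ → w ∈ S → defect a q (cauchyTransform μ) w = 0 := by
    intro S hSo hSc hS v hv hvA hwS
    have hana : AnalyticOnNhd ℂ (defect a q (cauchyTransform μ)) S :=
      DifferentiableOn.analyticOnNhd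
        (fun u hu => (hdiff u (hS u hu)).differentiableWithinAt) hSo
    exact hana.eqOn_zero_of_preconnected_of_eventuallyEq_zero hSc hv (hev v (hS v hv) hvA) hwS
  have hnorm : ∀ s : ℝ, |s| = 1 → A + 3 < ‖((s * (A + 4) : ℝ) : ℂ) * Complex.I‖ := by
    intro s hs
    rw [norm_mul, Complex.norm_I, mul_one, Complex.norm_real, Real.norm_eq_abs, abs_mul, hs,
      abs_of_pos (by linarith)]
    linarith
  rcases hw.lt_or_gt with hlt | hgt
  · exact hconn {v | v.im < 0} (isOpen_lt Complex.continuous_im continuous_const)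
      (convex_halfSpace_im_lt 0).isPreconnected (fun v hv => ne_of_lt hv)
      (((-1) * (A + 4) : ℝ) * Complex.I) (by simp; linarith) (hnorm (-1) (by simp)) hlt
  · exact hconn {v | 0 < v.im} (isOpen_lt continuous_const Complex.continuous_im)
      (convex_halfSpace_im_gt 0).isPreconnected (fun v hv => ne_of_gt hv)
      ((1 * (A + 4) : ℝ) * Complex.I) (by simp; linarith) (hnorm 1 (by simp)) hgt

theorem defect_cauchyTransform_eq_zero {μ : Measure ℝ} [IsProbabilityMeasure μ]
    (ha : ∀ j, |a j| ≤ A) (hA : 0 ≤ A)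
    (h : ∀ w : ℂ, w.im ≠ 0 → A + 3 ≤ ‖w‖ → ‖cauchyTransform μ w‖ ≤ 1 / 2 ∧
      cauchyTransform μ w = ∑ j, (q j : ℂ) * (w - a j - cauchyTransform μ w)⁻¹)
    {w : ℂ} (hw : w ∉ (fun x : ℝ => (x : ℂ)) '' {x : ℝ | ∀ U ∈ nhds x, μ U ≠ 0}) :
    defect a q (cauchyTransform μ) w = 0 := by
  rcases ne_or_eq w.im 0 with him | him
  · exact defect_cauchyTransform_eq_zero_of_im_ne_zero ha hA h him
  obtain ⟨y, rfl⟩ : ∃ y : ℝ, (y : ℂ) = w := ⟨w.re, Complex.ext (by simp) (by simp [him])⟩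
  have hy : ¬ ∀ U ∈ nhds y, μ U ≠ 0 := fun hy => hw ⟨y, hy, rfl⟩
  push Not at hy
  obtain ⟨U, hU, hU0⟩ := hy
  obtain ⟨δ, hδ, hball⟩ := Metric.mem_nhds_iff.1 hU
  have hae : ∀ᵐ x : ℝ ∂μ, δ ≤ ‖(y : ℂ) - x‖ := by
    refine measure_mono_null (fun x hx => hball ?_) hU0
    have hx' : ¬ δ ≤ ‖(y : ℂ) - x‖ := hx
    rw [Metric.mem_ball, dist_comm, Real.dist_eq]
    rw [← Complex.ofReal_sub, Complex.norm_real, Real.norm_eq_abs] at hx'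
    exact not_le.1 hx'
  have hcont := (differentiableAt_defect (a := a) (q := q)
    (differentiableAt_cauchyTransform μ hδ hae)).continuousAt
  have hpath : Tendsto (fun t : ℝ => (y : ℂ) + t * Complex.I) (nhdsWithin 0 (Set.Ioi 0))
      (nhds (y : ℂ)) := by
    have : Continuous fun t : ℝ => (y : ℂ) + t * Complex.I := by fun_prop
    have := this.tendsto 0
    simp only [Complex.ofReal_zero, zero_mul, add_zero] at this
    exact this.mono_left nhdsWithin_le_nhds
  refine tendsto_nhds_unique (hcont.tendsto.comp hpath) (tendsto_const_nhds.congr' ?_)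
  filter_upwards [self_mem_nhdsWithin] with t ht
  refine (defect_cauchyTransform_eq_zero_of_im_ne_zero ha hA h ?_).symm
  simpa using (ne_of_gt ht : t ≠ 0)

end FixedPoint

end MultipleHermite

open MeasureTheory Finset Filter BoundedContinuousFunction

open MultipleHermite

/-- (Theorem ThHermite.) There is a compactly supported probability
measure `μ*` on ℝ such that the zero counting measures of the rescaled multiple Hermite
polynomials `H_{n^{(N)}}^{(√N a₁,…,√N a_r)}(√N x)` converge weakly to `μ*`, and whose
Cauchy–Stieltjes transform `G` satisfies, outside the support of `μ*`,
`G(z)·∏ᵢ(z − G(z) − aᵢ) = ∑ᵢ qᵢ ∏_{j≠i}(z − G(z) − a_j)`. -/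
theorem statement17
    (r : ℕ) (hr : 2 ≤ r)
    (a : Fin r → ℝ) (hainj : Function.Injective a)
    (qw : Fin r → ℝ) (hqw : ∀ j, qw j ∈ Set.Ioo (0 : ℝ) 1) (hqwsum : ∑ j, qw j = 1)
    (nn : ℕ → Fin r → ℕ)
    (hnnsum : ∀ N : ℕ, 1 ≤ N → ∑ j, nn N j = N)
    (hnnmono : ∀ N j, nn N j ≤ nn (N + 1) j)
    (hnnlim : ∀ j, Filter.Tendsto (fun N : ℕ => (nn N j : ℝ) / (N : ℝ))
      Filter.atTop (nhds (qw j)))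
    (H : (Fin r → ℝ) → (Fin r → ℕ) → Polynomial ℝ)
    (hmonic : ∀ (c : Fin r → ℝ), Function.Injective c →
      ∀ n : Fin r → ℕ, (H c n).Monic ∧ (H c n).natDegree = ∑ j, n j)
    (hMOP : ∀ (c : Fin r → ℝ), Function.Injective c → ∀ n : Fin r → ℕ,
      ∀ j : Fin r, ∀ k : ℕ, k < n j →
        ∫ t : ℝ, t ^ k * (H c n).eval t * Real.exp (c j * t) * Real.exp (-t ^ 2 / 2) = 0)
    (z : (N : ℕ) → Fin N → ℝ)
    (hz : ∀ N : ℕ, 1 ≤ N →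
      H (fun j => Real.sqrt N * a j) (nn N)
        = ∏ i : Fin N, (Polynomial.X - Polynomial.C (z N i))) :
    ∃ (μstar : Measure ℝ) (G : ℂ → ℂ),
      IsProbabilityMeasure μstar ∧
      (∃ K : Set ℝ, IsCompact K ∧ μstar Kᶜ = 0) ∧
      (∀ f : ℝ →ᵇ ℝ,
        Filter.Tendsto (fun N : ℕ =>
            (N : ℝ)⁻¹ * ∑ i : Fin N, f (z N i / Real.sqrt N))
          Filter.atTop (nhds (∫ x, f x ∂μstar))) ∧
      (∀ w : ℂ, G w = ∫ x : ℝ, (w - (x : ℂ))⁻¹ ∂μstar) ∧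
      (∀ w : ℂ,
        w ∉ (fun x : ℝ => (x : ℂ)) '' {x : ℝ | ∀ U ∈ nhds x, μstar U ≠ 0} →
        G w * ∏ i : Fin r, (w - G w - (a i : ℂ))
          = ∑ i : Fin r, (qw i : ℂ)
              * ∏ j ∈ Finset.univ.erase i, (w - G w - (a j : ℂ))) := by

  classical
  obtain ⟨A, hA0, hA⟩ : ∃ A : ℝ, 0 ≤ A ∧ ∀ j, |a j| ≤ A :=
    ⟨∑ j, |a j|, Finset.sum_nonneg fun j _ => abs_nonneg _, fun j =>
      Finset.single_le_sum (f := fun j => |a j|) (fun j _ => abs_nonneg _) (mem_univ j)⟩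
  have hH : ∀ N : ℕ, 0 < N → multHermite (fun j => √N * a j) (nn N) =
      ∏ i : Fin N, (Polynomial.X - Polynomial.C (z N i)) := by
    intro N hN
    have hinj : Function.Injective fun j => √N * a j := fun i j hij =>
      hainj (mul_left_cancel₀ (Real.sqrt_pos.2 (by exact_mod_cast hN)).ne' hij)
    obtain ⟨hm, hd⟩ := hmonic _ hinj (nn N)
    rw [← hz N hN]
    refine (eq_heat_of_orthogonal hinj hm hd fun j k hk => ?_).symm
    simpa [gaussInt] using hMOP _ hinj (nn N) j k hk
  have hemp : ∀ N : ℕ, ∃ ν : ProbabilityMeasure ℝ, 0 < N →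
      (∀ s : Set ℝ, MeasurableSet s → (∀ i, z N i / √N ∉ s) → (ν : Measure ℝ) s = 0) ∧
      (∀ f : ℝ → ℝ, ∫ t, f t ∂(ν : Measure ℝ) = (N : ℝ)⁻¹ * ∑ i, f (z N i / √N)) ∧
      ∀ f : ℝ → ℂ, ∫ t, f t ∂(ν : Measure ℝ) = (N : ℂ)⁻¹ * ∑ i, f (z N i / √N) := by
    intro N
    rcases Nat.eq_zero_or_pos N with rfl | hN
    · exact ⟨⟨Measure.dirac 0, inferInstance⟩, fun h => absurd h (lt_irrefl _)⟩
    · obtain ⟨ν, hν⟩ := exists_empirical_measure hN fun i => z N i / √N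
      exact ⟨ν, fun _ => hν⟩
  choose ν hν using hemp
  let K : Set (ProbabilityMeasure ℝ) := {μ | ∀ _ : ℕ, μ (Set.Icc (-(A + 3)) (A + 3))ᶜ ≤ 0}
  have hK : IsCompact K :=
    isCompact_setOfPred_probabilityMeasure_mass_eq_compl_isCompact_le (u := fun _ => 0)
      tendsto_const_nhds (fun _ => isCompact_Icc) (Or.inl inferInstance)
  have hKmem : ∀ μ : ProbabilityMeasure ℝ,
      μ ∈ K ↔ (μ : Measure ℝ) (Set.Icc (-(A + 3)) (A + 3))ᶜ = 0 := by
    intro μ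
    simp [K]
  have hνK : ∀ᶠ N in atTop, ν N ∈ K := by
    filter_upwards [eventually_gt_atTop 0] with N hN
    rw [hKmem]
    refine (hν N hN).1 _ measurableSet_Icc.compl fun i hi => hi ?_
    exact abs_le.1 (abs_zero_lt hN hA (hnnsum N hN) (hH N hN) i).le
  have hfix : ∀ μ : ProbabilityMeasure ℝ, MapClusterPt μ atTop ν → ∀ w : ℂ, w.im ≠ 0 →
      A + 3 ≤ ‖w‖ → ‖cauchyTransform μ w‖ ≤ 1 / 2 ∧
      cauchyTransform μ w = ∑ j, (qw j : ℂ) * (w - a j - cauchyTransform μ w)⁻¹ := by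
    intro μ hμ w him hw
    obtain ⟨F, hF, hFμ⟩ := mapClusterPt_iff_ultrafilter.1 hμ
    have hb : ∀ N : ℕ, 0 < N → ‖cauchyTransform (ν N) w‖ ≤ 1 / 2 ∧
        ‖cauchyTransform (ν N) w - ∑ j, ((nn N j : ℂ) / N) *
          (w - a j - cauchyTransform (ν N) w)⁻¹‖ ≤ 1 / N := by
      intro N hN
      obtain ⟨-, g, hg, h1, h2⟩ := cauchy_zeros_bounds hN hA hw (hnnsum N hN) (hH N hN)
      have : cauchyTransform (ν N) w = g := by
        rw [cauchyTransform, (hν N hN).2.2, hg]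
      rw [this]
      exact ⟨h1, h2⟩
    refine fixedPoint_of_tendsto hA hw (p := fun N j => (nn N j : ℂ) / N) (ε := fun N => 1 / N)
      (fun j => ?_) (tendsto_cauchyTransform hFμ him)
      (tendsto_one_div_atTop_nhds_zero_nat.mono_left hF)
      (hF ((eventually_gt_atTop 0).mono fun N hN => (hb N hN).1))
      (hF ((eventually_gt_atTop 0).mono fun N hN => (hb N hN).2))
    have := ((Complex.continuous_ofReal.tendsto _).comp (hnnlim j)).mono_left hF
    simpa [Function.comp_def] using this
  obtain ⟨μ, hμK, hμ⟩ := hK.exists_mapClusterPt_of_frequently hνK.frequently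
  have huniq : ∀ μ' ∈ K, MapClusterPt μ' atTop ν → μ' = μ := by
    intro μ' hμ'K hμ'
    refine Subtype.ext (eq_of_cauchyTransform_eq (μ := (μ' : Measure ℝ)) (μ' := (μ : Measure ℝ))
      ((hKmem μ').1 hμ'K) ((hKmem μ).1 hμK) fun w him hw => ?_)
    obtain ⟨h1, h2⟩ := hfix μ hμ w him hw
    obtain ⟨h3, h4⟩ := hfix μ' hμ' w him hw
    exact fixedPoint_unique hA (fun j => (hqw j).1.le) hqwsum hw h3 h1 h4 h2
  have hlim : Tendsto ν atTop (nhds μ) := hK.tendsto_nhds_of_unique_mapClusterPt hνK huniq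
  refine ⟨μ, cauchyTransform μ, inferInstance, ⟨_, isCompact_Icc, (hKmem _).1 hμK⟩, fun f => ?_,
    fun w => rfl, fun w hw => ?_⟩
  · refine (ProbabilityMeasure.tendsto_iff_forall_integral_tendsto.1 hlim f).congr' ?_
    filter_upwards [eventually_gt_atTop 0] with N hN
    exact (hν N hN).2.1 f
  · exact sub_eq_zero.1 (defect_cauchyTransform_eq_zero hA hA0 (hfix μ hμ) hw)
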